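/- arXiv:1401.4650 — 5 statements merged into one kernel-verified Lean document; each statement's English description precedes it below -/
import Mathlib

section
/- For every q ≥ 3 and n ≥ 1, the last word of the list G_{n,q} is (q−1)1^{n−1} if q is odd, and (q−1)^n if q is even. -/
/-- Hamming distance between two words (of the same length): number of differing positions. -/
def hamming (a b : List ℕ) : ℕ :=
  ((a.zip b).filter (fun p => p.1 ≠ p.2)).length

/-- The generalized reflected Gray code list `G_{n,q}` over the alphabet `{1,…,q-1}`. -/
def G (q : ℕ) : ℕ → List (List ℕ)
  | 0 => [[]]
  | n + 1 =>
    (List.range (q - 1)).flatMap (fun j =>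
      (if (j + 1) % 2 = 1 then G q n else (G q n).reverse).map (fun w => (j + 1) :: w))

/-- Replace the 1's of a binary word (first arg), read from left to right,
by the letters of the second word. -/
def subst : List ℕ → List ℕ → List ℕ
  | [], _ => []
  | 0 :: β, w => 0 :: subst β w
  | _ :: β, w => w.headD 0 :: subst β w.tail

/-- The expansion `ε(β)` of a binary word `β` w.r.t. the alphabet `{0,…,q-1}`. -/
def expand (q : ℕ) (β : List ℕ) : List (List ℕ) :=
  (G q (β.count 1)).map (fun w => subst β w)

/-- The trace of a word: replace every nonzero letter by 1. -/
def trace (w : List ℕ) : List ℕ := w.map (fun x => if x = 0 then 0 else 1)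

/-- The modified binary reflected Gray code list `C_n`. -/
def C : ℕ → List (List ℕ)
  | 0 => [[]]
  | n + 1 => (C n).reverse.map (fun w => 1 :: w) ++ (C n).map (fun w => 0 :: w)

/-- The Gray code list `F_n^{(k)}` of length-`n` binary words avoiding `k` consecutive 0's. -/
def F (k n : ℕ) : List (List ℕ) :=
  if h : n < k then C n
  else (List.range k).attach.flatMap (fun ℓ =>
    ((F k (n - 1 - ℓ.1)).reverse).map (fun w => List.replicate ℓ.1 0 ++ 1 :: w))
termination_by n
decreasing_by
  have := List.mem_range.mp ℓ.2
  omega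

/-- The list `H_{n,q}^{(k)}`. -/
def H (q k n : ℕ) : List (List ℕ) :=
  ((F k (n - 2)).zipIdx.map Prod.swap).flatMap (fun p =>
    if p.1 % 2 = 0 then expand q (1 :: (p.2 ++ [1]))
    else (expand q (1 :: (p.2 ++ [1]))).reverse)

/-- The list `S_{n,q}^{(k)}`. -/
def S (q k n : ℕ) : List (List ℕ) :=
  (H q k (n - k)).map (fun w => List.replicate k 0 ++ w)

/-- The `k`-Fibonacci numbers. -/
def kfib (k n : ℕ) : ℕ :=
  if n < k then 2 ^ n
  else ∑ i ∈ (Finset.range k).attach, kfib k (n - 1 - i.1)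
termination_by n
decreasing_by
  have := Finset.mem_range.mp i.2
  omega

/-- The list `F_n^{(k)}(u)` (second recursive definition). -/
def Faux (k : ℕ) : ℕ → ℕ → List (List ℕ)
  | 0, _ => [[]]
  | n + 1, 0 => (Faux k n (k - 1)).reverse.map (fun w => 1 :: w)
  | n + 1, u + 1 =>
    (Faux k n (k - 1)).reverse.map (fun w => 1 :: w) ++ (Faux k n u).map (fun w => 0 :: w)


theorem G_head_aux (m n : ℕ) : (G (m + 2) n).head? = some (List.replicate n 1) := by
  induction n with
  | zero => simp [G]
  | succ n ih =>
    rw [G, show m + 2 - 1 = m + 1 from rfl, List.range_succ_eq_map, List.flatMap_cons,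
      List.head?_append]
    simp [ih, List.replicate_succ]

theorem G_last_step_aux (m n : ℕ) (w : List ℕ)
    (h : (if (m + 1) % 2 = 1 then G (m + 2) n else (G (m + 2) n).reverse).getLast? = some w) :
    (G (m + 2) (n + 1)).getLast? = some ((m + 1) :: w) := by
  rw [G, show m + 2 - 1 = m + 1 from rfl, List.range_succ, List.flatMap_append,
    List.getLast?_append, List.flatMap_singleton, List.getLast?_map, h]
  simp

theorem G_last_even_aux (m n : ℕ) (hm : (m + 1) % 2 = 1) :
    (G (m + 2) n).getLast? = some (List.replicate n (m + 1)) := by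
  induction n with
  | zero => simp [G]
  | succ n ih =>
    rw [List.replicate_succ]
    apply G_last_step_aux
    rw [if_pos hm, ih]

/-- For every `q ≥ 3` and `n ≥ 1`, the last word of the list `G_{n,q}` is `(q-1)1^{n-1}`
if `q` is odd, and `(q-1)^n` if `q` is even. -/
theorem stmt_1 (q n : ℕ) (hq : 3 ≤ q) (hn : 1 ≤ n) :
    (G q n).getLast? =
      some (if q % 2 = 1 then (q - 1) :: List.replicate (n - 1) 1
            else List.replicate n (q - 1)) := by
  obtain ⟨m, rfl⟩ : ∃ m, q = m + 2 := ⟨q - 2, by omega⟩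
  obtain ⟨k, rfl⟩ : ∃ k, n = k + 1 := ⟨n - 1, by omega⟩
  split_ifs with h
  · apply G_last_step_aux
    rw [if_neg (by omega), List.getLast?_reverse, G_head_aux]
    rfl
  · exact G_last_even_aux m (k + 1) (by omega)
end

section
/- For every q ≥ 2 and n ≥ 0, any two consecutive words of the list G_{n,q} have Hamming distance exactly 1, i.e., they differ in exactly one position. -/
theorem hamming_self_aux (a : List ℕ) : hamming a a = 0 := by
  induction a with
  | nil => rfl
  | cons x t ih => simpa [hamming] using ih

theorem hamming_comm_aux (a b : List ℕ) : hamming a b = hamming b a := by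
  induction a generalizing b with
  | nil => cases b <;> rfl
  | cons x t ih =>
    cases b with
    | nil => rfl
    | cons y u =>
      have h := ih u
      unfold hamming at h ⊢
      by_cases hxy : x = y
      · subst hxy
        simpa using h
      · have hyx : ¬ y = x := fun e => hxy e.symm
        simpa [List.filter_cons, hxy, hyx] using h

theorem hamming_cons_same (c : ℕ) (a b : List ℕ) :
    hamming (c :: a) (c :: b) = hamming a b := by
  simp [hamming]

theorem hamming_cons_ne (c d : ℕ) (h : c ≠ d) (a : List ℕ) :
    hamming (c :: a) (d :: a) = 1 := by
  have := hamming_self_aux a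
  unfold hamming at this ⊢
  rw [List.zip_cons_cons, List.filter_cons_of_pos (by simpa using h), List.length_cons, this]

theorem G_ne_nil (q n : ℕ) (hq : 2 ≤ q) : G q n ≠ [] := by
  induction n with
  | zero => simp [G]
  | succ n ih =>
    intro h
    rw [G, List.flatMap_eq_nil_iff] at h
    have := h 0 (by simp; omega)
    simp [ih] at this

theorem G_chain (q n : ℕ) (hq : 2 ≤ q) :
    (G q n).IsChain (fun a b => hamming a b = 1) := by
  induction n with
  | zero => simp [G]
  | succ n ih =>
    have hne := G_ne_nil q n hq
    rw [G, List.flatMap_def, List.isChain_flatten]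
    · refine ⟨?_, ?_⟩
      · intro l hl
        obtain ⟨j, -, rfl⟩ := List.mem_map.1 hl
        rw [List.isChain_map]
        simp only [hamming_cons_same]
        split_ifs
        · exact ih
        · rw [List.isChain_reverse]
          exact ih.imp (fun a b h => (hamming_comm_aux b a).trans h)
      · rw [List.isChain_map, List.isChain_range]
        intro m _ x hx y hy
        rw [List.getLast?_map] at hx
        rw [List.head?_map] at hy
        obtain ⟨u, hu, rfl⟩ := Option.mem_map.1 hx
        obtain ⟨v, hv, rfl⟩ := Option.mem_map.1 hy
        have huv : u = v := by
          rcases Nat.mod_two_eq_zero_or_one (m + 1) with h | h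
          · have h' : (m.succ + 1) % 2 = 1 := by omega
            rw [if_neg (by omega), List.getLast?_reverse] at hu
            rw [if_pos h'] at hv
            exact Option.mem_unique hu hv
          · rw [if_pos h] at hu
            rw [if_neg (by omega), List.head?_reverse] at hv
            exact Option.mem_unique hu hv
        subst huv
        exact hamming_cons_ne _ _ (by omega) _
    · intro h
      obtain ⟨j, -, hj⟩ := List.mem_map.1 h
      rw [List.map_eq_nil_iff] at hj
      split_ifs at hj
      · exact hne hj
      · exact hne (by simpa using hj)

/-- For every `q ≥ 2` and `n ≥ 0`, any two consecutive words of the list `G_{n,q}`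
differ in exactly one position. -/
theorem stmt_2 (q n : ℕ) (hq : 2 ≤ q) (i : ℕ) (a b : List ℕ)
    (ha : (G q n)[i]? = some a) (hb : (G q n)[i + 1]? = some b) :
    hamming a b = 1 := by
  have h := List.isChain_iff_getElem.1 (G_chain q n hq)
  obtain ⟨h1, rfl⟩ := List.getElem?_eq_some_iff.1 ha
  obtain ⟨h2, rfl⟩ := List.getElem?_eq_some_iff.1 hb
  exact h i h2
end

section
/- For every q ≥ 2 and n ≥ 0, the list G_{n,q} has exactly (q−1)^n entries and contains every word of length n over the alphabet {1,2,…,q−1} exactly once. -/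
lemma block_length (L : List (List ℕ)) (m : ℕ) :
    ((List.range m).flatMap (fun j =>
      (if (j + 1) % 2 = 1 then L else L.reverse).map (fun w => (j + 1) :: w))).length
      = m * L.length := by
  induction m with
  | zero => simp
  | succ m ih =>
    rw [List.range_succ, List.flatMap_append, List.length_append, ih, List.flatMap_singleton,
      List.length_map]
    split_ifs <;> simp [Nat.succ_mul]

lemma count_map_cons (a x : ℕ) (w : List ℕ) (L : List (List ℕ)) :
    (L.map (fun w => a :: w)).count (x :: w) = if a = x then L.count w else 0 := by
  induction L with
  | nil => simp
  | cons b L ih =>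
    rw [List.map_cons, List.count_cons, ih, List.count_cons]
    by_cases h : a = x <;> simp [h]

lemma block_count (L : List (List ℕ)) (x : ℕ) (w : List ℕ) (m : ℕ) :
    ((List.range m).flatMap (fun j =>
      (if (j + 1) % 2 = 1 then L else L.reverse).map (fun w => (j + 1) :: w))).count (x :: w)
      = if 1 ≤ x ∧ x ≤ m then L.count w else 0 := by
  induction m with
  | zero =>
    have : ¬ (1 ≤ x ∧ x ≤ 0) := by omega
    rw [if_neg this]; simp
  | succ m ih =>
    rw [List.range_succ, List.flatMap_append, List.count_append, ih, List.flatMap_singleton,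
      count_map_cons]
    have hc : (if (m + 1) % 2 = 1 then L else L.reverse).count w = L.count w := by
      split_ifs <;> simp
    rw [hc]
    split_ifs <;> omega

/-- For every `q ≥ 2` and `n ≥ 0`, the list `G_{n,q}` has exactly `(q-1)^n` entries and
contains every word of length `n` over the alphabet `{1,…,q-1}` exactly once. -/
theorem stmt_3 (q n : ℕ) (hq : 2 ≤ q) :
    (G q n).length = (q - 1) ^ n ∧
    ∀ w : List ℕ, w.length = n → (∀ x ∈ w, 1 ≤ x ∧ x ≤ q - 1) → (G q n).count w = 1 := by
  induction n with
  | zero =>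
    refine ⟨by simp [G], ?_⟩
    intro w hw _
    rw [List.length_eq_zero_iff] at hw
    subst hw
    simp [G]
  | succ n ih =>
    refine ⟨?_, ?_⟩
    · rw [G, block_length, ih.1, pow_succ, mul_comm]
    · intro w hw hx
      match w, hw, hx with
      | x :: w, hw, hx =>
        rw [G, block_count, if_pos (hx x (by simp))]
        exact ih.2 w (by simpa using hw) (fun y hy => hx y (by simp [hy]))
end

section
/- For every k ≥ 2 and n ≥ 0, the list F_n^{(k)} contains exactly once each binary word of length n that does not contain k consecutive 0's, and contains no other words. -/
theorem C_mem (n : ℕ) : ∀ w : List ℕ, w ∈ C n ↔ w.length = n ∧ ∀ x ∈ w, x = 0 ∨ x = 1 := by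
  induction n with
  | zero => intro w; cases w <;> simp [C]
  | succ n ih =>
    intro w
    cases w with
    | nil => simp [C]
    | cons a t =>
      simp only [C, List.mem_append, List.mem_map, List.mem_reverse, List.cons.injEq,
        List.length_cons, List.mem_cons, forall_eq_or_imp, add_left_inj]
      constructor
      · rintro (⟨v, hv, h1, rfl⟩ | ⟨v, hv, h1, rfl⟩)
        · have := (ih v).1 hv
          exact ⟨this.1, Or.inr h1.symm, this.2⟩
        · have := (ih v).1 hv
          exact ⟨this.1, Or.inl h1.symm, this.2⟩
      · rintro ⟨h, h0 | h0, h2⟩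
        · exact Or.inr ⟨t, (ih t).2 ⟨h, h2⟩, h0.symm, rfl⟩
        · exact Or.inl ⟨t, (ih t).2 ⟨h, h2⟩, h0.symm, rfl⟩

theorem C_nodup (n : ℕ) : (C n).Nodup := by
  induction n with
  | zero => simp [C]
  | succ n ih =>
    rw [C, List.nodup_append']
    refine ⟨(List.nodup_reverse.2 ih).map (fun a b h => by simpa using h),
      ih.map (fun a b h => by simpa using h), ?_⟩
    intro x hx hy
    simp only [List.mem_map] at hx hy
    obtain ⟨a, -, rfl⟩ := hx
    obtain ⟨b, -, hb⟩ := hy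
    simp at hb

theorem zeros_inj (l : ℕ) : ∀ (m : ℕ) (w v : List ℕ),
    List.replicate l 0 ++ 1 :: w = List.replicate m 0 ++ 1 :: v → l = m ∧ w = v := by
  induction l with
  | zero =>
    intro m w v h
    cases m with
    | zero => simpa using h
    | succ m => simp [List.replicate_succ] at h
  | succ l ih =>
    intro m w v h
    cases m with
    | zero => simp [List.replicate_succ] at h
    | succ m =>
      simp only [List.replicate_succ, List.cons_append, List.cons.injEq, true_and] at h
      have := ih m w v h
      exact ⟨by omega, this.2⟩

theorem zeros_prefix (l : ℕ) : ∀ (k : ℕ) (w : List ℕ),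
    List.replicate k 0 <+: List.replicate l 0 ++ 1 :: w ↔ k ≤ l := by
  induction l with
  | zero =>
    intro k w
    cases k with
    | zero => simp
    | succ k => simp [List.replicate_succ]
  | succ l ih =>
    intro k w
    cases k with
    | zero => simp
    | succ k =>
      simp only [List.replicate_succ, List.cons_append, List.cons_prefix_cons, true_and, ih,
        add_le_add_iff_right]

theorem zeros_infix (k : ℕ) (hk : 0 < k) (w : List ℕ) (l : ℕ) :
    List.replicate k 0 <:+: List.replicate l 0 ++ 1 :: w ↔ k ≤ l ∨ List.replicate k 0 <:+: w := by
  induction l with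
  | zero =>
    have := zeros_prefix 0 k w
    simp only [List.replicate_zero, List.nil_append] at this ⊢
    rw [List.infix_cons_iff, this]
  | succ l ih =>
    have := zeros_prefix (l + 1) k w
    simp only [List.replicate_succ, List.cons_append] at this ⊢
    rw [List.infix_cons_iff, this, ih]
    constructor
    · rintro (h | h | h)
      · exact Or.inl h
      · exact Or.inl (by omega)
      · exact Or.inr h
    · rintro (h | h)
      · exact Or.inl h
      · exact Or.inr (Or.inr h)

theorem binary_split (w : List ℕ) (hw : ∀ x ∈ w, x = 0 ∨ x = 1) :
    w = List.replicate w.length 0 ∨ ∃ l v, w = List.replicate l 0 ++ 1 :: v := by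
  induction w with
  | nil => simp
  | cons a t ih =>
    rcases hw a (by simp) with rfl | rfl
    · rcases ih (fun x hx => hw x (by simp [hx])) with h | ⟨l, v, h⟩
      · left
        rw [List.length_cons, List.replicate_succ, ← h]
      · right
        exact ⟨l + 1, v, by simp [List.replicate_succ, h]⟩
    · exact Or.inr ⟨0, t, by simp⟩

theorem F_ge (k n : ℕ) (h : k ≤ n) : F k n = (List.range k).flatMap (fun l =>
    ((F k (n - 1 - l)).reverse).map (fun w => List.replicate l 0 ++ 1 :: w)) := by
  rw [F, dif_neg (by omega)]
  simp [List.flatMap_subtype]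

theorem F_lt (k n : ℕ) (h : n < k) : F k n = C n := by
  rw [F, dif_pos h]

theorem F_mem (k : ℕ) (hk : 0 < k) (n : ℕ) : ∀ w : List ℕ, w ∈ F k n ↔
    w.length = n ∧ (∀ x ∈ w, x = 0 ∨ x = 1) ∧ ¬ (List.replicate k 0 <:+: w) := by
  induction n using Nat.strong_induction_on with
  | _ n ih =>
  intro w
  rcases lt_or_ge n k with h | h
  · rw [F_lt k n h, C_mem]
    constructor
    · rintro ⟨h1, h2⟩
      refine ⟨h1, h2, fun h3 => ?_⟩
      have := h3.length_le
      simp at this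
      omega
    · rintro ⟨h1, h2, -⟩
      exact ⟨h1, h2⟩
  · rw [F_ge k n h]
    simp only [List.mem_flatMap, List.mem_range, List.mem_map, List.mem_reverse]
    constructor
    · rintro ⟨l, hl, v, hv, rfl⟩
      obtain ⟨h1, h2, h3⟩ := (ih _ (by omega) v).1 hv
      refine ⟨by simp; omega, ?_, ?_⟩
      · intro x hx
        simp only [List.mem_append, List.mem_replicate, List.mem_cons] at hx
        rcases hx with hx | hx | hx
        · exact Or.inl hx.2
        · exact Or.inr hx
        · exact h2 x hx
      · rw [zeros_infix k hk]
        rintro (h4 | h4)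
        · omega
        · exact h3 h4
    · rintro ⟨h1, h2, h3⟩
      rcases binary_split w h2 with h4 | ⟨l, v, rfl⟩
      · exfalso
        apply h3
        rw [h4, h1]
        refine ⟨[], List.replicate (n - k) 0, ?_⟩
        rw [List.nil_append, List.replicate_append_replicate]
        congr 1
        omega
      · rw [zeros_infix k hk] at h3
        push Not at h3
        refine ⟨l, h3.1, v, (ih _ (by omega) v).2 ⟨?_, ?_, h3.2⟩, rfl⟩
        · simp at h1
          omega
        · intro x hx
          exact h2 x (by simp [hx])

theorem F_nodup (k n : ℕ) : (F k n).Nodup := by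
  induction n using Nat.strong_induction_on with
  | _ n ih =>
  rcases lt_or_ge n k with h | h
  · rw [F_lt k n h]
    exact C_nodup n
  · rw [F_ge k n h, List.nodup_flatMap]
    constructor
    · intro l hl
      have := List.mem_range.1 hl
      exact (List.nodup_reverse.2 (ih _ (by omega))).map
        (fun a b hab => (zeros_inj l l a b hab).2)
    · refine List.Pairwise.imp ?_ (List.nodup_range (n := k))
      intro a b hab x hx hy
      simp only [List.mem_map] at hx hy
      obtain ⟨u, -, rfl⟩ := hx
      obtain ⟨v, -, hv⟩ := hy
      exact hab (zeros_inj _ _ _ _ hv).1.symm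

/-- For every `k ≥ 2` and `n ≥ 0`, the list `F_n^{(k)}` contains exactly once each binary word
of length `n` with no `k` consecutive 0's, and contains no other words. -/
theorem stmt_8 (k n : ℕ) (hk : 2 ≤ k) :
    ∀ w : List ℕ, (F k n).count w =
      if w.length = n ∧ (∀ x ∈ w, x = 0 ∨ x = 1) ∧ ¬ (List.replicate k 0 <:+: w)
      then 1 else 0 := by
  intro w
  have hm := F_mem k (by omega) n w
  split_ifs with h
  · exact List.count_eq_one_of_mem (F_nodup k n) (hm.2 h)
  · exact List.count_eq_zero_of_not_mem (fun h' => h (hm.1 h'))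
end

section
/- For every k ≥ 2 and n ≥ 1, the last word of the list F_n^{(k)} is the length-n prefix of the infinite periodic word (0^{k−1}11)(0^{k−1}11)(0^{k−1}11)…. -/
theorem C_last (n : ℕ) : (C n).getLast? = some (List.replicate n 0) := by
  induction n with
  | zero => simp [C]
  | succ n ih => simp [C, List.getLast?_append, List.getLast?_map, ih, List.replicate_succ]

theorem F_head (k m : ℕ) (hk : 2 ≤ k) (x : List ℕ) (hx : (F k m).getLast? = some x) :
    (F k (m + 1)).head? = some (1 :: x) := by
  by_cases h : m + 1 < k
  · rw [F_lt k _ h]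
    rw [F_lt k m (by omega)] at hx
    simp [C, List.head?_append, hx]
  · rw [F_ge k _ (by omega)]
    obtain ⟨j, rfl⟩ : ∃ j, k = j + 1 := ⟨k - 1, by omega⟩
    rw [List.range_succ_eq_map, List.flatMap_cons, List.head?_append]
    simp [hx]

theorem F_last (k n : ℕ) (hk : 2 ≤ k) (h : k ≤ n) (x : List ℕ)
    (hx : (F k (n - k)).head? = some x) :
    (F k n).getLast? = some (List.replicate (k - 1) 0 ++ 1 :: x) := by
  rw [F_ge k _ h]
  obtain ⟨j, rfl⟩ : ∃ j, k = j + 1 := ⟨k - 1, by omega⟩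
  rw [List.range_succ, List.flatMap_append, List.getLast?_append]
  have e : n - 1 - j = n - (j + 1) := by omega
  simp [e, hx]

theorem take_per (W : List ℕ) (hW : 1 ≤ W.length) (m d : ℕ) :
    ((List.replicate (m + d) W).flatten).take m = ((List.replicate m W).flatten).take m := by
  rw [List.replicate_add, List.flatten_append, List.take_append_of_le_length]
  simp
  nlinarith

theorem last_all (k : ℕ) (hk : 2 ≤ k) (n : ℕ) : (F k n).getLast? =
      some (((List.replicate n (List.replicate (k - 1) 0 ++ [1, 1])).flatten).take n) := by
  induction n using Nat.strong_induction_on with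
  | _ n ih =>
  by_cases h : n < k
  · rw [F_lt k n h, C_last]
    cases n with
    | zero => simp
    | succ m =>
      rw [List.replicate_succ (n := m) (a := _ ++ _), List.flatten_cons, List.append_assoc,
        List.take_append_of_le_length (by simp; omega), List.take_replicate]
      congr 2
      omega
  · by_cases h2 : n = k
    · subst h2
      rw [F_last n n hk le_rfl [] (by rw [Nat.sub_self, F_lt n 0 (by omega)]; simp [C])]
      obtain ⟨j, rfl⟩ : ∃ j, n = j + 1 := ⟨n - 1, by omega⟩
      rw [List.replicate_succ (n := j) (a := _ ++ _), List.flatten_cons, List.append_assoc,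
        List.take_append]
      simp
    · obtain ⟨m, rfl⟩ : ∃ m, n = k + 1 + m := ⟨n - k - 1, by omega⟩
      have e : k + 1 + m - k = m + 1 := by omega
      rw [F_last k _ hk (by omega) _ (by rw [e]; exact F_head k m hk _ (ih m (by omega)))]
      have e2 : k + 1 + m = (m + k) + 1 := by omega
      rw [e2, List.replicate_succ (n := m + k) (a := _ ++ _), List.flatten_cons, List.take_append,
        List.take_of_length_le (l := List.replicate (k - 1) 0 ++ [1, 1]) (by simp; omega)]
      have e3 : m + k + 1 - (List.replicate (k - 1) 0 ++ [1, 1]).length = m := by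
        simp; omega
      rw [e3, take_per _ (by simp)]
      simp

/-- For every `k ≥ 2` and `n ≥ 1`, the last word of `F_n^{(k)}` is the length-`n` prefix
of the infinite periodic word `(0^{k-1}11)(0^{k-1}11)…`. -/
theorem stmt_11 (k n : ℕ) (hk : 2 ≤ k) (hn : 1 ≤ n) :
    (F k n).getLast? =
      some (((List.replicate n (List.replicate (k - 1) 0 ++ [1, 1])).flatten).take n) := by
  exact last_all k hk n
end
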